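/- Let V be the real symmetric circulant n×n matrix (n odd) with V_{i,i}=1, V_{i,j} = -c for |i-j|=1 (mod n, i.e. including the pair (1,n)), V_{i,j}=0 otherwise, where 0<c<1/2. Then V is positive definite with λ_min(V) ≥ 1-2c and ‖V‖ ≤ 1+2c, and its inverse is given entrywise by (V^{-1})_{i,j} = ((1+q²)/((q^n-1)(q²-1)))·(q^{n-|i-j|} + q^{|i-j|}), where q = (1-√(1-4c²))/(2c) ∈ (0,1). -/

import Mathlib

/-- The ℓ² operator norm of a real matrix. -/
noncomputable def opNorm {n : Type*} [Fintype n] [DecidableEq n] (M : Matrix n n ℝ) : ℝ :=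
  ‖(Matrix.toEuclideanCLM (𝕜 := ℝ) M)‖

/-- The circulant matrix `V = 1 - c E` of the `n`-cycle: diagonal `1`, entries `-c` on the
cyclically adjacent pairs, `0` otherwise. (Vertices `0, …, n-1` stand for `1, …, n`.) -/
def cycleMatrix (n : ℕ) (c : ℝ) : Matrix (Fin n) (Fin n) ℝ := fun i j =>
  if i = j then 1
  else if ((i : ℤ) - (j : ℤ)).natAbs = 1 ∨ ((i : ℤ) - (j : ℤ)).natAbs = n - 1 then -c
  else 0

open scoped Matrix.Norms.L2Operator in
theorem opNorm_permMatrix_le {n : Type*} [Fintype n] [DecidableEq n] (σ : Equiv.Perm n) :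
    opNorm (σ.permMatrix ℝ) ≤ 1 :=
  Matrix.permMatrix_l2_opNorm_le (𝕜 := ℝ) σ

theorem cycleMatrix_eq_permMatrix (m : ℕ) (hm : 2 ≤ m) (c : ℝ) :
    cycleMatrix (m + 1) c = 1 - c • ((Equiv.addRight (1 : Fin (m + 1))).permMatrix ℝ
      + (Equiv.addRight (1 : Fin (m + 1)))⁻¹.permMatrix ℝ) := by
  obtain ⟨k, rfl⟩ : ∃ k, m = k + 2 := ⟨m - 2, by omega⟩
  ext i j
  have h_next : i + 1 = j ↔ (if i = Fin.last (k + 2) then 0 else (i : ℕ) + 1) = (j : ℕ) := by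
    rw [Fin.ext_iff, Fin.val_add_one]
  have h_prev : i - 1 = j ↔ (if i = 0 then k + 2 else (i : ℕ) - 1) = (j : ℕ) := by
    rw [Fin.ext_iff, Fin.coe_sub_one]
  have h_inv : (Equiv.addRight (1 : Fin (k + 2 + 1)))⁻¹ i = i - 1 := by
    rw [Equiv.Perm.inv_eq_iff_eq]; simp
  simp only [cycleMatrix, Matrix.sub_apply, Matrix.smul_apply, Matrix.add_apply,
    Matrix.one_apply, PEquiv.toMatrix_apply, Equiv.toPEquiv_apply, Option.mem_some_iff,
    Equiv.coe_addRight, h_inv, h_next, h_prev, smul_eq_mul]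
  have hi := i.isLt
  have hj := j.isLt
  simp only [Fin.ext_iff, Fin.val_last, Fin.val_zero]
  split_ifs <;> first | omega | ring

/-- With `σ` a permutation matrix, `2 - σ - σ⁻¹ = (1 - σ)ᴴ (1 - σ)`. -/
theorem posSemidef_two_sub_permMatrix_add_inv {n : Type*} [Fintype n] [DecidableEq n]
    (σ : Equiv.Perm n) :
    ((2 : ℝ) • (1 : Matrix n n ℝ) - (σ.permMatrix ℝ + σ⁻¹.permMatrix ℝ)).PosSemidef := by
  have h := Matrix.posSemidef_conjTranspose_mul_self (1 - σ.permMatrix ℝ)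
  have hσ : σ⁻¹.permMatrix ℝ * σ.permMatrix ℝ = 1 := by
    rw [← Matrix.permMatrix_mul, mul_inv_cancel, Matrix.permMatrix_one]
  convert h using 1
  rw [Matrix.conjTranspose_sub, Matrix.conjTranspose_permMatrix, Matrix.conjTranspose_one,
    sub_mul, mul_sub, mul_sub, hσ, two_smul]
  simp only [one_mul, mul_one]
  abel

theorem opNorm_one_sub_smul_permMatrix_add_inv_le {n : Type*} [Fintype n] [DecidableEq n]
    (σ : Equiv.Perm n) {c : ℝ} (hc : 0 ≤ c) :
    opNorm (1 - c • (σ.permMatrix ℝ + σ⁻¹.permMatrix ℝ)) ≤ 1 + 2 * c := by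
  have h₁ := opNorm_permMatrix_le σ
  have h₂ := opNorm_permMatrix_le σ⁻¹
  have h₀ := opNorm_permMatrix_le (1 : Equiv.Perm n)
  rw [Matrix.permMatrix_one] at h₀
  unfold opNorm at *
  rw [map_sub, map_smul, map_add]
  refine (norm_sub_le _ _).trans ?_
  rw [norm_smul, Real.norm_of_nonneg hc]
  have h := mul_le_mul_of_nonneg_left ((norm_add_le _ _).trans (add_le_add h₁ h₂)) hc
  linarith

/-- The reflection-symmetric profile `k ↦ q ^ (n - k) + q ^ k` evaluated at `|i - j|` depends
only on `i - j` modulo `n`. -/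
theorem pow_sub_natAbs_add_pow_natAbs {m : ℕ} (q : ℝ) (i j : Fin (m + 1)) :
    q ^ (m + 1 - ((i : ℤ) - (j : ℤ)).natAbs) + q ^ ((i : ℤ) - (j : ℤ)).natAbs
      = q ^ (m + 1 - ((i - j : Fin (m + 1)) : ℕ)) + q ^ ((i - j : Fin (m + 1)) : ℕ) := by
  have hi := i.isLt
  have hj := j.isLt
  rcases le_or_gt j i with h | h
  · rw [Fin.coe_sub_iff_le.2 h]
    have h' : (j : ℕ) ≤ i := h
    rw [show ((i : ℤ) - (j : ℤ)).natAbs = (i : ℕ) - j by omega]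
  · rw [Fin.coe_sub_iff_lt.2 h]
    have h' : (i : ℕ) < j := h
    rw [show ((i : ℤ) - (j : ℤ)).natAbs = (j : ℕ) - i by omega,
      show m + 1 - (m + 1 + (i : ℕ) - j) = (j : ℕ) - i by omega,
      show m + 1 + (i : ℕ) - j = m + 1 - ((j : ℕ) - i) by omega, add_comm]

/-- The profile `k ↦ q ^ (n - k) + q ^ k` is, up to a factor, the Green function of the cycle. -/
theorem green_recurrence {m : ℕ} (q : ℝ) (d : Fin (m + 1)) :
    (1 + q ^ 2) * (q ^ (m + 1 - (d : ℕ)) + q ^ (d : ℕ))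
      - q * ((q ^ (m + 1 - ((d + 1 : Fin (m + 1)) : ℕ)) + q ^ ((d + 1 : Fin (m + 1)) : ℕ))
        + (q ^ (m + 1 - ((d - 1 : Fin (m + 1)) : ℕ)) + q ^ ((d - 1 : Fin (m + 1)) : ℕ)))
      = if d = 0 then (q ^ (m + 1) - 1) * (q ^ 2 - 1) else 0 := by
  have h_next : q ^ (m + 1 - ((d + 1 : Fin (m + 1)) : ℕ)) + q ^ ((d + 1 : Fin (m + 1)) : ℕ)
      = q ^ (m - (d : ℕ)) + q ^ ((d : ℕ) + 1) := by
    rw [Fin.val_add_one]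
    split_ifs with h
    · simp [h, add_comm]
    · rw [Nat.add_sub_add_right]
  rw [h_next, Fin.coe_sub_one]
  split_ifs with h
  · subst h
    simp only [Fin.val_zero, Nat.sub_zero, Nat.add_sub_cancel_left]
    ring
  · obtain ⟨a, ha⟩ : ∃ a, (d : ℕ) = a + 1 :=
      Nat.exists_eq_succ_of_ne_zero (fun h' => h (Fin.ext h'))
    obtain ⟨b, hb⟩ : ∃ b, m = a + 1 + b := ⟨m - (a + 1), by have := d.isLt; omega⟩
    rw [ha, show m + 1 - (a + 1) = b + 1 by omega, show m - (a + 1) = b by omega,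
      show m + 1 - (a + 1 - 1) = b + 2 by omega, Nat.add_sub_cancel]
    ring

theorem cycleMatrix_mul_green {m : ℕ} (hm : 2 ≤ m) {c q : ℝ} (hq0 : 0 < q) (hq1 : q < 1)
    (hcq : c * (1 + q ^ 2) = q) :
    cycleMatrix (m + 1) c * (Matrix.of fun i j : Fin (m + 1) =>
      ((1 + q ^ 2) / ((q ^ (m + 1) - 1) * (q ^ 2 - 1))) *
        (q ^ (m + 1 - ((i : ℤ) - (j : ℤ)).natAbs) + q ^ (((i : ℤ) - (j : ℤ)).natAbs))) = 1 := by
  have h_inv : ∀ i, (Equiv.addRight (1 : Fin (m + 1)))⁻¹ i = i - 1 := fun i => by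
    rw [Equiv.Perm.inv_eq_iff_eq]; simp
  have h_pow : q ^ (m + 1) - 1 ≠ 0 := (sub_neg.2 (pow_lt_one₀ hq0.le hq1 (by omega))).ne
  have h_sq : q ^ 2 - 1 ≠ 0 := (sub_neg.2 (pow_lt_one₀ hq0.le hq1 (by omega))).ne
  rw [cycleMatrix_eq_permMatrix m hm, sub_mul, one_mul, smul_mul_assoc, add_mul,
    PEquiv.toMatrix_toPEquiv_mul, PEquiv.toMatrix_toPEquiv_mul]
  ext i j
  simp only [pow_sub_natAbs_add_pow_natAbs, Matrix.sub_apply, Matrix.smul_apply,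
    Matrix.add_apply, Matrix.submatrix_apply, Matrix.of_apply, Equiv.coe_addRight, h_inv, id,
    smul_eq_mul, Matrix.one_apply]
  have key := green_recurrence q (i - j)
  rw [show i - j + 1 = i + 1 - j by abel, show i - j - 1 = i - 1 - j by abel] at key
  simp only [sub_eq_zero] at key
  set D := (q ^ (m + 1) - 1) * (q ^ 2 - 1)
  have hD0 : D ≠ 0 := mul_ne_zero h_pow h_sq
  generalize q ^ (m + 1 - ((i - j : Fin (m + 1)) : ℕ)) + q ^ ((i - j : Fin (m + 1)) : ℕ) = x
    at key ⊢
  generalize q ^ (m + 1 - ((i + 1 - j : Fin (m + 1)) : ℕ)) + q ^ ((i + 1 - j : Fin (m + 1)) : ℕ)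
    = y at key ⊢
  generalize q ^ (m + 1 - ((i - 1 - j : Fin (m + 1)) : ℕ)) + q ^ ((i - 1 - j : Fin (m + 1)) : ℕ)
    = z at key ⊢
  calc _ = ((1 + q ^ 2) * x - c * (1 + q ^ 2) * (y + z)) / D := by ring
    _ = (if i = j then D else 0) / D := by rw [hcq, key]
    _ = _ := by split_ifs <;> simp [hD0]

theorem root_pos_lt_one_and_eq {c : ℝ} (hc0 : 0 < c) (hc : c < 1 / 2) :
    0 < (1 - Real.sqrt (1 - 4 * c ^ 2)) / (2 * c) ∧
    (1 - Real.sqrt (1 - 4 * c ^ 2)) / (2 * c) < 1 ∧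
    c * (1 + ((1 - Real.sqrt (1 - 4 * c ^ 2)) / (2 * c)) ^ 2)
      = (1 - Real.sqrt (1 - 4 * c ^ 2)) / (2 * c) := by
  have h0 : 0 ≤ 1 - 4 * c ^ 2 := by nlinarith
  have hs := Real.sq_sqrt h0
  have hs0 := Real.sqrt_nonneg (1 - 4 * c ^ 2)
  generalize Real.sqrt (1 - 4 * c ^ 2) = s at hs hs0
  refine ⟨div_pos (by nlinarith) (by linarith), ?_, ?_⟩
  · rw [div_lt_one (by linarith)]
    nlinarith
  · field_simp
    linear_combination hs

/-- For `n ≥ 3` odd and `0 < c < 1/2`, the circulant matrix `V = 1 - c E` of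
the `n`-cycle is positive definite with `λ_min(V) ≥ 1 - 2c` (i.e. `V - (1-2c)·1` is positive
semidefinite) and `‖V‖ ≤ 1 + 2c`, and its inverse is given entrywise by
`(V⁻¹)_{ij} = ((1+q²)/((qⁿ-1)(q²-1))) (q^{n-|i-j|} + q^{|i-j|})` with
`q = (1-√(1-4c²))/(2c) ∈ (0,1)`. -/
theorem cycle_matrix_inverse (n : ℕ) (hn3 : 3 ≤ n) (hodd : Odd n)
    (c : ℝ) (hc0 : 0 < c) (hc : c < 1 / 2) :
    (cycleMatrix n c).PosDef ∧
    (cycleMatrix n c - (1 - 2 * c) • (1 : Matrix (Fin n) (Fin n) ℝ)).PosSemidef ∧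
    opNorm (cycleMatrix n c) ≤ 1 + 2 * c ∧
    (0 < (1 - Real.sqrt (1 - 4 * c ^ 2)) / (2 * c) ∧
      (1 - Real.sqrt (1 - 4 * c ^ 2)) / (2 * c) < 1) ∧
    cycleMatrix n c *
        (Matrix.of fun i j : Fin n =>
          ((1 + ((1 - Real.sqrt (1 - 4 * c ^ 2)) / (2 * c)) ^ 2) /
              ((((1 - Real.sqrt (1 - 4 * c ^ 2)) / (2 * c)) ^ n - 1) *
                (((1 - Real.sqrt (1 - 4 * c ^ 2)) / (2 * c)) ^ 2 - 1))) *
            (((1 - Real.sqrt (1 - 4 * c ^ 2)) / (2 * c)) ^ (n - ((i : ℤ) - (j : ℤ)).natAbs) +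
              ((1 - Real.sqrt (1 - 4 * c ^ 2)) / (2 * c)) ^ (((i : ℤ) - (j : ℤ)).natAbs))) =
      1 := by
  obtain ⟨m, rfl⟩ : ∃ m, n = m + 1 := ⟨n - 1, by omega⟩
  have hm : 2 ≤ m := by omega
  obtain ⟨hq0, hq1, hcq⟩ := root_pos_lt_one_and_eq hc0 hc
  have hpsd : (cycleMatrix (m + 1) c
      - (1 - 2 * c) • (1 : Matrix (Fin (m + 1)) (Fin (m + 1)) ℝ)).PosSemidef := by
    convert (posSemidef_two_sub_permMatrix_add_inv
      (Equiv.addRight (1 : Fin (m + 1)))).smul hc0.le using 1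
    rw [cycleMatrix_eq_permMatrix m hm]
    module
  refine ⟨?_, hpsd, ?_, ⟨hq0, hq1⟩, cycleMatrix_mul_green hm hq0 hq1 hcq⟩
  · have h : 0 < 1 - 2 * c := by linarith
    simpa using Matrix.PosDef.posSemidef_add hpsd (Matrix.PosDef.one.smul h)
  · rw [cycleMatrix_eq_permMatrix m hm]
    exact opNorm_one_sub_smul_permMatrix_add_inv_le _ hc0.le
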